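/- arXiv:2101.10695 — 2 statements merged into one kernel-verified Lean document; each statement's English description precedes it below -/
import Mathlib

section
/- Let μ be a log-concave probability measure supported on the whole ℝⁿ, with density e^{−φ} where φ : ℝⁿ → ℝ is convex and globally Lipschitz with constant L, and let C_P be a Poincaré constant of μ. Fix x₀ ∈ ℝⁿ and let γ be the Gaussian measure on ℝⁿ centered at x₀ with covariance (n/L²)·Id. Then log χ²(γ|μ) ≤ n(1+σ₀) + (n/2) log(L² C_P / n), where σ₀ = (φ(x₀) − inf_{ℝⁿ} φ)/n. -/
open MeasureTheory ProbabilityTheory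

/-- Squared 2-Wasserstein distance between two measures on `ℝⁿ`:
the infimum of `∫ ‖x - y‖²` over all couplings. -/
noncomputable def W2sq {n : ℕ}
    (μ ν : Measure (EuclideanSpace ℝ (Fin n))) : ℝ :=
  sInf { c : ℝ | ∃ γ : Measure (EuclideanSpace ℝ (Fin n) × EuclideanSpace ℝ (Fin n)),
    γ.map Prod.fst = μ ∧ γ.map Prod.snd = ν ∧ c = ∫ p, ‖p.1 - p.2‖ ^ 2 ∂γ }

/-- The Gaussian measure on `ℝⁿ` centered at `m` with covariance `c • Id`. -/
noncomputable def gaussianPi (n : ℕ) (m : EuclideanSpace ℝ (Fin n)) (c : ℝ) :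
    Measure (EuclideanSpace ℝ (Fin n)) :=
  volume.withDensity fun x =>
    ENNReal.ofReal ((2 * Real.pi * c) ^ (-(n : ℝ) / 2) * Real.exp (-‖x - m‖ ^ 2 / (2 * c)))

/-- `μ` satisfies the logarithmic Sobolev inequality with constant `C`. -/
def SatisfiesLogSobolev {n : ℕ} (μ : Measure (EuclideanSpace ℝ (Fin n))) (C : ℝ) : Prop :=
  ∀ f : EuclideanSpace ℝ (Fin n) → ℝ, ContDiff ℝ (⊤ : ℕ∞) f → HasCompactSupport f →
    ∫ x, f x ^ 2 * Real.log (f x ^ 2 / ∫ y, f y ^ 2 ∂μ) ∂μ ≤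
      2 * C * ∫ x, ‖gradient f x‖ ^ 2 ∂μ

/-- `μ` satisfies the Poincaré inequality with constant `C`. -/
def SatisfiesPoincare {n : ℕ} (μ : Measure (EuclideanSpace ℝ (Fin n))) (C : ℝ) : Prop :=
  ∀ f : EuclideanSpace ℝ (Fin n) → ℝ, ContDiff ℝ (⊤ : ℕ∞) f → HasCompactSupport f →
    ∫ x, (f x - ∫ y, f y ∂μ) ^ 2 ∂μ ≤ C * ∫ x, ‖gradient f x‖ ^ 2 ∂μ

/-- Chi-square divergence `χ²(ν | μ) = ∫ (dν/dμ - 1)² dμ`. -/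
noncomputable def chiSq {n : ℕ} (ν μ : Measure (EuclideanSpace ℝ (Fin n))) : ℝ :=
  ∫ x, ((ν.rnDeriv μ x).toReal - 1) ^ 2 ∂μ

theorem norm_gradient_eq {n : ℕ} (f : EuclideanSpace ℝ (Fin n) → ℝ) (x) :
    ‖gradient f x‖ = ‖fderiv ℝ f x‖ := by
  simp [gradient]

/-- A smooth compactly supported function that coincides with a coordinate on the unit ball. -/
theorem exists_cutoff {n : ℕ} (i : Fin n) : ∃ F : EuclideanSpace ℝ (Fin n) → ℝ,
    ContDiff ℝ (⊤ : ℕ∞) F ∧ HasCompactSupport F ∧ ∀ y, ‖y‖ < 1 → F y = y i := by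
  let η : ContDiffBump (0 : EuclideanSpace ℝ (Fin n)) := ⟨1, 2, by norm_num, by norm_num⟩
  refine ⟨fun y => y i * η y, ?_, ?_, ?_⟩
  · have : ContDiff ℝ (⊤ : ℕ∞) (fun y : EuclideanSpace ℝ (Fin n) => y i) :=
      (EuclideanSpace.proj (𝕜 := ℝ) i).contDiff
    exact this.mul η.contDiff
  · exact η.hasCompactSupport.mul_left
  · intro y hy
    have : η y = 1 := η.one_of_mem_closedBall (by simpa [η] using hy.le)
    simp [this]


/-- From the Poincaré inequality for compactly supported functions: the second moment of a
coordinate about a suitable point is at most the Poincaré constant. -/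
theorem coord_moment {n : ℕ} (μ : Measure (EuclideanSpace ℝ (Fin n))) [IsProbabilityMeasure μ]
    (C : ℝ) (hC : 0 < C) (hP : SatisfiesPoincare μ C) (i : Fin n) :
    ∃ a : ℝ, ∫⁻ x, ENNReal.ofReal ((x i - a) ^ 2) ∂μ ≤ ENNReal.ofReal C := by
  obtain ⟨F, hF, hFc, hF1⟩ := exists_cutoff i
  let f : ℕ → EuclideanSpace ℝ (Fin n) → ℝ := fun k x => ((k : ℝ) + 1) * F (((k : ℝ) + 1)⁻¹ • x)
  have hk : ∀ k : ℕ, (0 : ℝ) < (k : ℝ) + 1 := fun k => by positivity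
  have hfs : ∀ k, ContDiff ℝ (⊤ : ℕ∞) (f k) := fun k =>
    contDiff_const.mul (hF.comp (contDiff_const_smul _))
  have hfc : ∀ k, HasCompactSupport (f k) := fun k =>
    (hFc.comp_smul (inv_ne_zero (hk k).ne')).mul_left
  have hfd : ∀ k x, fderiv ℝ (f k) x = fderiv ℝ F (((k : ℝ) + 1)⁻¹ • x) := by
    intro k x
    have h1 : HasFDerivAt F (fderiv ℝ F (((k : ℝ) + 1)⁻¹ • x)) (((k : ℝ) + 1)⁻¹ • x) :=
      (hF.differentiable (by simp) _).hasFDerivAt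
    have h2 : HasFDerivAt (fun x : EuclideanSpace ℝ (Fin n) => ((k : ℝ) + 1)⁻¹ • x)
        (((k : ℝ) + 1)⁻¹ • ContinuousLinearMap.id ℝ (EuclideanSpace ℝ (Fin n))) x :=
      HasFDerivAt.fun_const_smul (hasFDerivAt_id x) (((k : ℝ) + 1)⁻¹)
    have h3 := (h1.comp x h2).const_mul ((k : ℝ) + 1)
    refine h3.fderiv.trans ?_
    ext v
    have := (hk k).ne'
    simp
    field_simp
  -- behaviour of the derivative of F
  have hFdc : Continuous (fderiv ℝ F) := hF.continuous_fderiv (by simp)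
  obtain ⟨D, hD⟩ : ∃ D, ∀ y, ‖fderiv ℝ F y‖ ≤ D := by
    obtain ⟨D, hD⟩ := (hFc.fderiv (𝕜 := ℝ)).exists_bound_of_continuous hFdc
    exact ⟨D, hD⟩
  have hD0 : 0 ≤ D := (norm_nonneg _).trans (hD 0)
  have hF0 : ‖fderiv ℝ F 0‖ ≤ 1 := by
    have hev : F =ᶠ[nhds 0] (EuclideanSpace.proj (𝕜 := ℝ) i : EuclideanSpace ℝ (Fin n) →L[ℝ] ℝ) := by
      filter_upwards [Metric.ball_mem_nhds (0 : EuclideanSpace ℝ (Fin n)) one_pos] with y hy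
      exact hF1 y (by simpa using hy)
    rw [hev.fderiv_eq, ContinuousLinearMap.fderiv]
    refine ContinuousLinearMap.opNorm_le_bound _ zero_le_one fun x => ?_
    simpa using PiLp.norm_apply_le x i
  have hscale : ∀ x : EuclideanSpace ℝ (Fin n), Filter.Tendsto (fun k : ℕ => ((k : ℝ) + 1)⁻¹ • x) Filter.atTop (nhds 0) := by
    intro x
    have : Filter.Tendsto (fun k : ℕ => ((k : ℝ) + 1)⁻¹) Filter.atTop (nhds 0) := by
      simpa using tendsto_one_div_add_atTop_nhds_zero_nat (𝕜 := ℝ)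
    simpa using this.smul_const x
  have hGlim : Filter.Tendsto (fun k => ∫ x, ‖gradient (f k) x‖ ^ 2 ∂μ) Filter.atTop
      (nhds (∫ _x, ‖fderiv ℝ F 0‖ ^ 2 ∂μ)) := by
    simp only [norm_gradient_eq, hfd]
    refine tendsto_integral_of_dominated_convergence (fun _ => D ^ 2) ?_ (integrable_const _) ?_ ?_
    · intro k
      exact Continuous.aestronglyMeasurable (by fun_prop)
    · intro k
      refine Filter.Eventually.of_forall fun x => ?_
      rw [Real.norm_of_nonneg (by positivity)]
      exact pow_le_pow_left₀ (norm_nonneg _) (hD _) 2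
    · refine Filter.Eventually.of_forall fun x => ?_
      exact (((hFdc.tendsto 0).comp (hscale x)).norm).pow 2
  have hGb : ∀ k, ∫ x, ‖gradient (f k) x‖ ^ 2 ∂μ ≤ D ^ 2 := by
    intro k
    have : ∫ x, ‖gradient (f k) x‖ ^ 2 ∂μ ≤ ∫ _x, D ^ 2 ∂μ := by
      refine integral_mono_of_nonneg (Filter.Eventually.of_forall fun x => by positivity)
        (integrable_const _) (Filter.Eventually.of_forall fun x => ?_)
      simp only [norm_gradient_eq, hfd]
      exact pow_le_pow_left₀ (norm_nonneg _) (hD _) 2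
    simpa using this
  set a : ℕ → ℝ := fun k => ∫ y, f k y ∂μ with ha
  have hPk : ∀ k, ∫ x, (f k x - a k) ^ 2 ∂μ ≤ C * ∫ x, ‖gradient (f k) x‖ ^ 2 ∂μ :=
    fun k => hP (f k) (hfs k) (hfc k)
  have hint : ∀ k, Integrable (fun x => (f k x - a k) ^ 2) μ := by
    intro k
    have h1 : MemLp (f k) 2 μ := (hfs k).continuous.memLp_of_hasCompactSupport (hfc k)
    exact (h1.sub (memLp_const (a k))).integrable_sq
  -- tightness
  obtain ⟨K, hK⟩ : ∃ K : ℕ, (1 / 2 : ENNReal) < μ (Metric.ball 0 K) := by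
    have hm : Monotone fun k : ℕ => Metric.ball (0 : EuclideanSpace ℝ (Fin n)) k := fun p q hpq =>
      Metric.ball_subset_ball (by exact_mod_cast hpq)
    have := tendsto_measure_iUnion_atTop (μ := μ) hm
    rw [Metric.iUnion_ball_nat, measure_univ] at this
    exact (this.eventually (lt_mem_nhds (by simp))).exists
  have hKr : (1 / 2 : ℝ) ≤ μ.real (Metric.ball 0 K) := by
    have := ENNReal.toReal_mono (measure_ne_top _ _) hK.le
    simpa [Measure.real] using this
  obtain ⟨T, hT0, hT⟩ : ∃ T : ℝ, 0 < T ∧ C * D ^ 2 < T ^ 2 * (1 / 2) := by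
    refine ⟨2 * C * D ^ 2 + 2, by positivity, ?_⟩
    have : 0 ≤ C * D ^ 2 := by positivity
    nlinarith
  have hab : ∀ k ≥ K, a k ∈ Metric.closedBall (0 : ℝ) (K + T) := by
    intro k hkK
    rw [mem_closedBall_zero_iff, Real.norm_eq_abs]
    by_contra! hcon
    have hkK' : (K : ℝ) ≤ k := by exact_mod_cast hkK
    have hsub : Metric.ball (0 : EuclideanSpace ℝ (Fin n)) K ⊆ {x | T ^ 2 ≤ (f k x - a k) ^ 2} := by
      intro x hx
      have hx : ‖x‖ < K := by simpa using hx
      have h1 : ‖((k : ℝ) + 1)⁻¹ • x‖ < 1 := by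
        rw [norm_smul, norm_inv, Real.norm_of_nonneg (hk k).le, inv_mul_lt_iff₀ (hk k)]
        linarith
      have h2 : f k x = x i := by
        simp only [f, hF1 _ h1]
        have := (hk k).ne'
        simp
        field_simp
      have h3 : |x i| ≤ ‖x‖ := by simpa using PiLp.norm_apply_le x i
      have h4 : T ≤ |f k x - a k| := by
        have := abs_sub_abs_le_abs_sub (a k) (x i)
        rw [h2, abs_sub_comm]
        linarith
      have := pow_le_pow_left₀ hT0.le h4 2
      simpa using this
    have h5 := mul_meas_ge_le_integral_of_nonneg
      (Filter.Eventually.of_forall fun x => sq_nonneg (f k x - a k)) (hint k) (T ^ 2)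
    have h6 : μ.real (Metric.ball (0 : EuclideanSpace ℝ (Fin n)) K) ≤ μ.real {x | T ^ 2 ≤ (f k x - a k) ^ 2} :=
      measureReal_mono hsub
    have h7 := mul_le_mul_of_nonneg_left (hKr.trans h6) (sq_nonneg T)
    have h8 := mul_le_mul_of_nonneg_left (hGb k) hC.le
    linarith [hPk k]
  obtain ⟨A, -, ψ, hψ, hA⟩ := tendsto_subseq_of_frequently_bounded
    Metric.isBounded_closedBall (x := a)
    ((Filter.eventually_ge_atTop K).mono hab).frequently
  refine ⟨A, ?_⟩
  have hflim : ∀ x : EuclideanSpace ℝ (Fin n), Filter.Tendsto (fun k => f k x) Filter.atTop (nhds (x i)) := by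
    intro x
    refine tendsto_const_nhds.congr' ?_
    have := (hscale x).eventually (Metric.ball_mem_nhds (0 : EuclideanSpace ℝ (Fin n)) one_pos)
    filter_upwards [this] with k h1
    have h1 : ‖((k : ℝ) + 1)⁻¹ • x‖ < 1 := by simpa using h1
    simp only [f, hF1 _ h1]
    have := (hk k).ne'
    simp
    field_simp
  have hpt : ∀ x : EuclideanSpace ℝ (Fin n), Filter.Tendsto
      (fun k => ENNReal.ofReal ((f (ψ k) x - a (ψ k)) ^ 2)) Filter.atTop
      (nhds (ENNReal.ofReal ((x i - A) ^ 2))) := by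
    intro x
    exact ENNReal.tendsto_ofReal ((((hflim x).comp hψ.tendsto_atTop).sub hA).pow 2)
  have hup : Filter.Tendsto
      (fun k => ENNReal.ofReal (C * ∫ x, ‖gradient (f (ψ k)) x‖ ^ 2 ∂μ)) Filter.atTop
      (nhds (ENNReal.ofReal (C * ∫ _x, ‖fderiv ℝ F 0‖ ^ 2 ∂μ))) :=
    ENNReal.tendsto_ofReal ((hGlim.comp hψ.tendsto_atTop).const_mul C)
  calc ∫⁻ x, ENNReal.ofReal ((x i - A) ^ 2) ∂μ
      = ∫⁻ x, Filter.liminf (fun k => ENNReal.ofReal ((f (ψ k) x - a (ψ k)) ^ 2)) Filter.atTop ∂μ :=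
        lintegral_congr fun x => (hpt x).liminf_eq.symm
    _ ≤ Filter.liminf (fun k => ∫⁻ x, ENNReal.ofReal ((f (ψ k) x - a (ψ k)) ^ 2) ∂μ)
        Filter.atTop := by
        refine lintegral_liminf_le fun k => ?_
        have := (hfs (ψ k)).continuous.measurable
        fun_prop
    _ ≤ Filter.liminf (fun k => ENNReal.ofReal (C * ∫ x, ‖gradient (f (ψ k)) x‖ ^ 2 ∂μ))
        Filter.atTop := by
        refine Filter.liminf_le_liminf (Filter.Eventually.of_forall fun k => ?_)
        rw [← ofReal_integral_eq_lintegral_ofReal (hint _)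
          (Filter.Eventually.of_forall fun x => sq_nonneg _)]
        exact ENNReal.ofReal_le_ofReal (hPk _)
    _ = ENNReal.ofReal (C * ∫ _x, ‖fderiv ℝ F 0‖ ^ 2 ∂μ) := hup.liminf_eq
    _ ≤ ENNReal.ofReal C := by
        refine ENNReal.ofReal_le_ofReal ?_
        simp only [integral_const, probReal_univ, one_smul]
        have : ‖fderiv ℝ F 0‖ ^ 2 ≤ 1 := pow_le_one₀ (norm_nonneg _) hF0
        nlinarith

theorem gauss_int {n : ℕ} (m : EuclideanSpace ℝ (Fin n)) {c : ℝ} (hc : 0 < c) :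
    Integrable (fun x => Real.exp (-‖x - m‖ ^ 2 / (2 * c))) ∧
    ∫ x, Real.exp (-‖x - m‖ ^ 2 / (2 * c)) = (2 * Real.pi * c) ^ ((n : ℝ) / 2) := by
  have h := GaussianFourier.integral_rexp_neg_mul_sq_norm
    (V := EuclideanSpace ℝ (Fin n)) (b := 1 / (2 * c)) (by positivity)
  have e : ∫ x, Real.exp (-‖x - m‖ ^ 2 / (2 * c)) = (2 * Real.pi * c) ^ ((n : ℝ) / 2) := by
    rw [integral_sub_right_eq_self
      (fun x : EuclideanSpace ℝ (Fin n) => Real.exp (-‖x‖ ^ 2 / (2 * c))) m]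
    rw [finrank_euclideanSpace_fin] at h
    have e1 : ∀ x : EuclideanSpace ℝ (Fin n),
        -‖x‖ ^ 2 / (2 * c) = -(1 / (2 * c)) * ‖x‖ ^ 2 := fun x => by ring
    have e2 : 2 * Real.pi * c = Real.pi / (1 / (2 * c)) := by
      rw [div_div_eq_mul_div, div_one]; ring
    simp only [e1]
    rw [h, e2]
  refine ⟨?_, e⟩
  by_contra hcon
  rw [integral_undef hcon] at e
  exact (Real.rpow_pos_of_pos (by positivity) _).ne e

theorem density_bdd {n : ℕ} (φ : EuclideanSpace ℝ (Fin n) → ℝ)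
    (L : ℝ) (hL : 0 < L) (hφLip : LipschitzWith (Real.toNNReal L) φ)
    (hi : Integrable (fun x => Real.exp (-φ x))) (h1 : ∫ x, Real.exp (-φ x) = 1) :
    BddBelow (Set.range φ) := by
  let V := (volume : Measure (EuclideanSpace ℝ (Fin n))).real (Metric.ball 0 1)
  have hV : 0 < V := by
    refine ENNReal.toReal_pos (Metric.measure_ball_pos _ _ one_pos).ne' measure_ball_lt_top.ne
  refine ⟨-L + Real.log V, ?_⟩
  rintro _ ⟨x, rfl⟩
  have hb : ∀ y ∈ Metric.ball x 1, Real.exp (-φ x - L) ≤ Real.exp (-φ y) := by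
    intro y hy
    have h2 := hφLip.dist_le_mul y x
    rw [Real.coe_toNNReal _ hL.le, Real.dist_eq] at h2
    have h3 : dist y x < 1 := hy
    have := le_abs_self (φ y - φ x)
    apply Real.exp_le_exp.2
    nlinarith
  have h4 : ∫ y in Metric.ball x 1, Real.exp (-φ x - L) ≤ ∫ y in Metric.ball x 1, Real.exp (-φ y) :=
    setIntegral_mono_on (integrableOn_const measure_ball_lt_top.ne) hi.integrableOn
      measurableSet_ball hb
  have h5 : ∫ y in Metric.ball x 1, Real.exp (-φ y) ≤ ∫ y, Real.exp (-φ y) :=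
    setIntegral_le_integral hi (Filter.Eventually.of_forall fun y => (Real.exp_pos _).le)
  have h6 : volume.real (Metric.ball x 1) = V := by
    simp only [V, Measure.real, Measure.addHaar_ball_center]
  rw [setIntegral_const, h6, smul_eq_mul] at h4
  have h7 : V * Real.exp (-φ x - L) ≤ 1 := by linarith
  have h8 := Real.log_le_log (by positivity) h7
  rw [Real.log_mul hV.ne' (Real.exp_pos _).ne', Real.log_exp, Real.log_one] at h8
  linarith

theorem inf_bound {n : ℕ} (φ : EuclideanSpace ℝ (Fin n) → ℝ) (hφ : Continuous φ)
    (μ : Measure (EuclideanSpace ℝ (Fin n)))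
    (hμ : μ = volume.withDensity fun x => ENNReal.ofReal (Real.exp (-φ x)))
    [IsProbabilityMeasure μ] (C : ℝ) (hC : 0 < C)
    (hmom : ∀ i, ∃ a : ℝ, ∫⁻ x, ENNReal.ofReal ((x i - a) ^ 2) ∂μ ≤ ENNReal.ofReal C)
    (I : ℝ) (hI : ∀ x, I ≤ φ x) :
    Real.exp I ≤ Real.exp (n / 2) * (2 * Real.pi * C) ^ ((n : ℝ) / 2) := by
  choose a ha using hmom
  let m : EuclideanSpace ℝ (Fin n) := WithLp.toLp 2 a
  have hcoord : ∀ i, Integrable (fun x : EuclideanSpace ℝ (Fin n) => (x i - a i) ^ 2) μ ∧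
      ∫ x, (x i - a i) ^ 2 ∂μ ≤ C := by
    intro i
    have hc : Continuous fun x : EuclideanSpace ℝ (Fin n) => (x i - a i) ^ 2 := by fun_prop
    refine ⟨⟨hc.aestronglyMeasurable, ?_⟩, ?_⟩
    · rw [hasFiniteIntegral_iff_ofReal (Filter.Eventually.of_forall fun x => sq_nonneg _)]
      exact (ha i).trans_lt ENNReal.ofReal_lt_top
    · rw [integral_eq_lintegral_of_nonneg_ae (Filter.Eventually.of_forall fun x => sq_nonneg _)
        hc.aestronglyMeasurable]
      exact ENNReal.toReal_le_of_le_ofReal hC.le (ha i)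
  have hsq : ∀ x : EuclideanSpace ℝ (Fin n), ‖x - m‖ ^ 2 = ∑ i, (x i - a i) ^ 2 := by
    intro x
    simp [EuclideanSpace.norm_sq_eq, m]
  have hqi : Integrable (fun x => ‖x - m‖ ^ 2) μ := by
    simp only [hsq]
    exact integrable_finsetSum _ fun i _ => (hcoord i).1
  have hq : ∫ x, ‖x - m‖ ^ 2 ∂μ ≤ n * C := by
    simp only [hsq]
    rw [integral_finsetSum _ fun i _ => (hcoord i).1]
    calc _ ≤ ∑ _i : Fin n, C := Finset.sum_le_sum fun i _ => (hcoord i).2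
      _ = n * C := by simp
  obtain ⟨gi, ge⟩ := gauss_int m hC
  have hm : Measurable fun x => ENNReal.ofReal (Real.exp (-φ x)) := by
    have := hφ.measurable
    fun_prop
  have hlow : Real.exp (-(n / 2 : ℝ)) ≤ ∫ x, Real.exp (-‖x - m‖ ^ 2 / (2 * C)) ∂μ := by
    have h1 : ∫ x, Real.exp (-(n / 2 : ℝ)) * (1 + n / 2 - ‖x - m‖ ^ 2 / (2 * C)) ∂μ ≤
        ∫ x, Real.exp (-‖x - m‖ ^ 2 / (2 * C)) ∂μ := by
      refine integral_mono (((integrable_const _).sub (hqi.div_const _)).const_mul _) ?_ ?_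
      · refine Integrable.of_bound (C := 1) (Continuous.aestronglyMeasurable (by fun_prop)) ?_
        refine Filter.Eventually.of_forall fun x => ?_
        rw [Real.norm_of_nonneg (Real.exp_pos _).le, Real.exp_le_one_iff, neg_div]
        exact neg_nonpos.2 (by positivity)
      · intro x
        have := Real.add_one_le_exp (n / 2 - ‖x - m‖ ^ 2 / (2 * C))
        have h2 := mul_le_mul_of_nonneg_left this (Real.exp_pos (-(n / 2 : ℝ))).le
        rw [← Real.exp_add] at h2
        convert h2 using 2 <;> ring
    refine le_trans ?_ h1
    rw [integral_const_mul, integral_sub (integrable_const _) (hqi.div_const _), integral_div]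
    simp only [integral_const, probReal_univ, one_smul]
    refine le_mul_of_one_le_right (Real.exp_pos _).le ?_
    have : (∫ x, ‖x - m‖ ^ 2 ∂μ) / (2 * C) ≤ n / 2 := by
      rw [div_le_div_iff₀ (by positivity) (by positivity)]
      linarith
    linarith
  have hup : ∫ x, Real.exp (-‖x - m‖ ^ 2 / (2 * C)) ∂μ ≤
      Real.exp (-I) * (2 * Real.pi * C) ^ ((n : ℝ) / 2) := by
    rw [hμ, integral_withDensity_eq_integral_toReal_smul hm
      (Filter.Eventually.of_forall fun x => ENNReal.ofReal_lt_top), ← ge, ← integral_const_mul]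
    refine integral_mono_of_nonneg (Filter.Eventually.of_forall fun x => by positivity)
      (gi.const_mul _) (Filter.Eventually.of_forall fun x => ?_)
    simp only [ENNReal.toReal_ofReal (Real.exp_pos _).le, smul_eq_mul]
    exact mul_le_mul_of_nonneg_right (Real.exp_le_exp.2 (neg_le_neg (hI x))) (Real.exp_pos _).le
  have h := hlow.trans hup
  rw [Real.exp_neg, Real.exp_neg, inv_mul_eq_div, le_div_iff₀ (Real.exp_pos _),
    inv_mul_le_iff₀ (Real.exp_pos _)] at h
  exact h

theorem chi_bound {n : ℕ} (hn : 1 ≤ n) (φ : EuclideanSpace ℝ (Fin n) → ℝ)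
    (L : ℝ) (hL : 0 < L) (hφLip : LipschitzWith (Real.toNNReal L) φ)
    (x₀ : EuclideanSpace ℝ (Fin n)) (c : ℝ) (hc : c = n / L ^ 2)
    (g : EuclideanSpace ℝ (Fin n) → ℝ)
    (hg : g = fun x => (2 * Real.pi * c) ^ (-(n : ℝ) / 2) * Real.exp (-‖x - x₀‖ ^ 2 / (2 * c))) :
    Integrable (fun x => g x ^ 2 * Real.exp (φ x)) ∧
    ∫ x, g x ^ 2 * Real.exp (φ x) ≤
      Real.exp (φ x₀ + n / 2) * (2 * Real.pi * c) ^ (-(n : ℝ) / 2) := by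
  have hn0 : (0 : ℝ) < n := by exact_mod_cast hn
  have hc0 : 0 < c := by rw [hc]; positivity
  obtain ⟨gi, ge⟩ := gauss_int x₀ hc0
  set Z := (2 * Real.pi * c) ^ (-(n : ℝ) / 2) with hZ
  have hZ0 : 0 < Z := Real.rpow_pos_of_pos (by positivity) _
  have hpt : ∀ x, g x ^ 2 * Real.exp (φ x) ≤
      (Z ^ 2 * Real.exp (φ x₀ + n / 2)) * Real.exp (-‖x - x₀‖ ^ 2 / (2 * c)) := by
    intro x
    have h2 := hφLip.dist_le_mul x x₀
    rw [Real.coe_toNNReal _ hL.le, Real.dist_eq, dist_eq_norm] at h2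
    have h3 := (le_abs_self (φ x - φ x₀)).trans h2
    have h4 : L * ‖x - x₀‖ ≤ n / 2 + ‖x - x₀‖ ^ 2 / (2 * c) := by
      have : n / 2 + ‖x - x₀‖ ^ 2 / (2 * c) - L * ‖x - x₀‖ =
          (n - L * ‖x - x₀‖) ^ 2 / (2 * n) := by
        rw [hc]; field_simp; ring
      have h5 : 0 ≤ (n - L * ‖x - x₀‖) ^ 2 / (2 * n) := by positivity
      linarith
    rw [hg]
    simp only [mul_pow, mul_assoc]
    refine mul_le_mul_of_nonneg_left ?_ (by positivity)
    rw [← Real.exp_nat_mul, ← Real.exp_add, ← Real.exp_add]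
    apply Real.exp_le_exp.2
    push_cast
    rw [neg_div]
    linarith
  have hφ := hφLip.continuous
  have hgc : Continuous g := by rw [hg]; fun_prop
  have hnn : ∀ x, 0 ≤ g x ^ 2 * Real.exp (φ x) := fun x => by positivity
  refine ⟨(gi.const_mul (Z ^ 2 * Real.exp (φ x₀ + n / 2))).mono' (Continuous.aestronglyMeasurable (by fun_prop))
    (Filter.Eventually.of_forall fun x => ?_), ?_⟩
  · rw [Real.norm_of_nonneg (hnn x)]; exact hpt x
  · refine (integral_mono_of_nonneg (Filter.Eventually.of_forall hnn) (gi.const_mul _)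
      (Filter.Eventually.of_forall hpt)).trans_eq ?_
    rw [integral_const_mul, ge]
    have : Z * (2 * Real.pi * c) ^ ((n : ℝ) / 2) = 1 := by
      rw [hZ, neg_div, Real.rpow_neg (by positivity)]
      exact inv_mul_cancel₀ (Real.rpow_pos_of_pos (by positivity) _).ne'
    linear_combination (Z * Real.exp (φ x₀ + n / 2)) * this

/-- **Lemma 4 (chi-square divergence of a Gaussian warm start).**
If `μ = e^{-φ} dx` is a log-concave probability measure on all of `ℝⁿ` with `φ` convex and
globally `L`-Lipschitz, `C_P` is a Poincaré constant of `μ`, and `γ` is the Gaussian measure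
centered at `x₀` with covariance `(n/L²) Id`, then
`log χ²(γ|μ) ≤ n (1 + σ₀) + (n/2) log(L² C_P / n)`. -/
theorem chiSq_gaussian_warmStart
    (n : ℕ) (hn : 1 ≤ n)
    (φ : EuclideanSpace ℝ (Fin n) → ℝ) (hφconv : ConvexOn ℝ Set.univ φ)
    (L : ℝ) (hL : 0 < L) (hφLip : LipschitzWith (Real.toNNReal L) φ)
    (μ : Measure (EuclideanSpace ℝ (Fin n)))
    (hμ : μ = volume.withDensity fun x => ENNReal.ofReal (Real.exp (-φ x)))
    (hμprob : IsProbabilityMeasure μ)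
    (CP : ℝ) (hCP : 0 < CP) (hPoin : SatisfiesPoincare μ CP)
    (x₀ : EuclideanSpace ℝ (Fin n))
    (σ₀ : ℝ) (hσ₀ : σ₀ = (φ x₀ - sInf (Set.range φ)) / n)
    (γ : Measure (EuclideanSpace ℝ (Fin n)))
    (hγ : γ = gaussianPi n x₀ (n / L ^ 2)) :
    Real.log (chiSq γ μ) ≤ n * (1 + σ₀) + (n / 2) * Real.log (L ^ 2 * CP / n) := by
  have hn0 : (0 : ℝ) < n := by exact_mod_cast hn
  have hφ := hφLip.continuous
  have hm : Measurable fun x => ENNReal.ofReal (Real.exp (-φ x)) := by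
    have := hφ.measurable
    fun_prop
  have hlt : ∀ᵐ x, ENNReal.ofReal (Real.exp (-φ x)) < ⊤ :=
    Filter.Eventually.of_forall fun x => ENNReal.ofReal_lt_top
  have hl1 : ∫⁻ x, ENNReal.ofReal (Real.exp (-φ x)) = 1 := by
    have := hμprob.measure_univ
    rwa [hμ, withDensity_apply _ MeasurableSet.univ, setLIntegral_univ] at this
  have hei : Integrable (fun x => Real.exp (-φ x)) := by
    refine ⟨Continuous.aestronglyMeasurable (by fun_prop), ?_⟩
    rw [hasFiniteIntegral_iff_ofReal (Filter.Eventually.of_forall fun x => (Real.exp_pos _).le),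
      hl1]
    exact ENNReal.one_lt_top
  have he1 : ∫ x, Real.exp (-φ x) = 1 := by
    rw [integral_eq_lintegral_of_nonneg_ae
      (Filter.Eventually.of_forall fun x => (Real.exp_pos _).le) hei.1, hl1, ENNReal.toReal_one]
  have hbdd := density_bdd φ L hL hφLip hei he1
  have hI : ∀ x, sInf (Set.range φ) ≤ φ x := fun x => csInf_le hbdd ⟨x, rfl⟩
  have hinf := inf_bound φ hφ μ hμ CP hCP (coord_moment μ CP hCP hPoin) _ hI
  obtain ⟨c, hc⟩ : ∃ c : ℝ, c = n / L ^ 2 := ⟨_, rfl⟩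
  have hc0 : 0 < c := by rw [hc]; positivity
  obtain ⟨g, hg⟩ : ∃ g : EuclideanSpace ℝ (Fin n) → ℝ, g = fun x =>
    (2 * Real.pi * c) ^ (-(n : ℝ) / 2) * Real.exp (-‖x - x₀‖ ^ 2 / (2 * c)) := ⟨_, rfl⟩
  obtain ⟨hsi, hsb⟩ := chi_bound hn φ L hL hφLip x₀ c hc g hg
  have hgc : Continuous g := by rw [hg]; fun_prop
  have hg0 : ∀ x, 0 ≤ g x := fun x => by rw [hg]; positivity
  obtain ⟨gi, ge⟩ := gauss_int x₀ hc0
  have hgi : Integrable g := by rw [hg]; exact gi.const_mul _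
  have hg1 : ∫ x, g x = 1 := by
    rw [hg, integral_const_mul, ge, neg_div, Real.rpow_neg (by positivity)]
    exact inv_mul_cancel₀ (Real.rpow_pos_of_pos (by positivity) _).ne'
  have hhm : Measurable fun x => ENNReal.ofReal (g x * Real.exp (φ x)) :=
    ENNReal.measurable_ofReal.comp (Continuous.measurable (by fun_prop))
  have hγμ : γ = μ.withDensity fun x => ENNReal.ofReal (g x * Real.exp (φ x)) := by
    rw [hγ, hμ, ← withDensity_mul _ hm hhm, gaussianPi, ← hc]
    congr 1
    ext x
    rw [Pi.mul_apply, ← ENNReal.ofReal_mul (Real.exp_pos _).le, hg]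
    congr 1
    rw [mul_left_comm, ← Real.exp_add]
    simp
  have hrn : γ.rnDeriv μ =ᵐ[μ] fun x => ENNReal.ofReal (g x * Real.exp (φ x)) := by
    rw [hγμ]
    exact Measure.rnDeriv_withDensity μ hhm
  have key : ∀ x, Real.exp (-φ x) * Real.exp (φ x) = 1 := fun x => by
    rw [← Real.exp_add]; simp
  have hh1 : Integrable (fun x => g x * Real.exp (φ x)) μ ∧
      ∫ x, g x * Real.exp (φ x) ∂μ = 1 := by
    rw [hμ, integrable_withDensity_iff hm hlt,
      integral_withDensity_eq_integral_toReal_smul hm hlt, ← hg1]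
    simp only [ENNReal.toReal_ofReal (Real.exp_pos _).le, smul_eq_mul]
    constructor
    · refine hgi.congr (Filter.Eventually.of_forall fun x => ?_)
      simp only
      linear_combination (-g x) * key x
    · refine integral_congr_ae (Filter.Eventually.of_forall fun x => ?_)
      simp only
      linear_combination (g x) * key x
  have hh2 : Integrable (fun x => (g x * Real.exp (φ x)) ^ 2) μ ∧
      ∫ x, (g x * Real.exp (φ x)) ^ 2 ∂μ = ∫ x, g x ^ 2 * Real.exp (φ x) := by
    rw [hμ, integrable_withDensity_iff hm hlt,
      integral_withDensity_eq_integral_toReal_smul hm hlt]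
    simp only [ENNReal.toReal_ofReal (Real.exp_pos _).le, smul_eq_mul]
    constructor
    · refine hsi.congr (Filter.Eventually.of_forall fun x => ?_)
      simp only
      linear_combination (-g x ^ 2 * Real.exp (φ x)) * key x
    · refine integral_congr_ae (Filter.Eventually.of_forall fun x => ?_)
      simp only
      linear_combination (g x ^ 2 * Real.exp (φ x)) * key x
  have hchi : chiSq γ μ = (∫ x, g x ^ 2 * Real.exp (φ x)) - 1 := by
    have h1 : chiSq γ μ =
        ∫ x, ((g x * Real.exp (φ x)) ^ 2 - 2 * (g x * Real.exp (φ x)) + 1) ∂μ := by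
      refine integral_congr_ae ?_
      filter_upwards [hrn] with x hx
      rw [hx, ENNReal.toReal_ofReal (mul_nonneg (hg0 x) (Real.exp_pos _).le)]
      ring
    have h2 : Integrable
        (fun x => (g x * Real.exp (φ x)) ^ 2 - 2 * (g x * Real.exp (φ x))) μ :=
      hh2.1.sub (hh1.1.const_mul 2)
    rw [h1, integral_add h2 (integrable_const _),
      integral_sub hh2.1 (hh1.1.const_mul 2), integral_const_mul, hh1.2, hh2.2]
    simp
    ring
  have hchi0 : 0 ≤ chiSq γ μ := integral_nonneg fun x => sq_nonneg _
  have hle : chiSq γ μ + 1 ≤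
      Real.exp (φ x₀ + n / 2) * (2 * Real.pi * c) ^ (-(n : ℝ) / 2) := by
    rw [hchi]; linarith
  have hlog1 : Real.log (chiSq γ μ) ≤ Real.log (chiSq γ μ + 1) := by
    rcases hchi0.eq_or_lt with h | h
    · rw [← h]; simp
    · exact Real.log_le_log h (by linarith)
  have hlog2 := Real.log_le_log (by linarith) hle
  have hpi := Real.pi_pos
  rw [Real.log_mul (Real.exp_pos _).ne' (Real.rpow_pos_of_pos (by positivity) _).ne',
    Real.log_exp, Real.log_rpow (by positivity), Real.log_mul (by positivity) hc0.ne'] at hlog2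
  have hlog3 := Real.log_le_log (Real.exp_pos _) hinf
  rw [Real.log_mul (Real.exp_pos _).ne' (Real.rpow_pos_of_pos (by positivity) _).ne',
    Real.log_exp, Real.log_exp, Real.log_rpow (by positivity),
    Real.log_mul (by positivity) hCP.ne'] at hlog3
  have hr : Real.log (L ^ 2 * CP / n) = Real.log CP - Real.log c := by
    rw [← Real.log_div hCP.ne' hc0.ne', hc]
    congr 1
    field_simp
  have hs : (n : ℝ) * (1 + σ₀) = n + (φ x₀ - sInf (Set.range φ)) := by
    rw [hσ₀]; field_simp
  rw [hr, hs]
  linarith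
end

section
/- Let μ be a log-concave probability measure on ℝⁿ with density e^{−φ} with respect to Lebesgue measure, where φ : ℝⁿ → ℝ is convex, and suppose μ satisfies the Poincaré inequality with constant C_P. Then inf_{ℝⁿ} φ ≤ ∫_{ℝⁿ} φ dμ ≤ (n/2) log(2πe C_P). -/
open MeasureTheory ProbabilityTheory

section Helpers

open Filter Topology

variable {n : ℕ}

lemma aux_mid {φ : EuclideanSpace ℝ (Fin n) → ℝ} (hφ : ConvexOn ℝ Set.univ φ)
    (x y : EuclideanSpace ℝ (Fin n)) :
    φ ((1 / 2 : ℝ) • (y + x)) ≤ (φ x + φ y) / 2 := by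
  have h := hφ.2 (Set.mem_univ y) (Set.mem_univ x)
    (show (0 : ℝ) ≤ 1 / 2 by norm_num) (show (0 : ℝ) ≤ 1 / 2 by norm_num) (by norm_num)
  rw [← smul_add] at h
  simp only [smul_eq_mul] at h
  linarith

lemma aux_half {φ : EuclideanSpace ℝ (Fin n) → ℝ} (hφ : ConvexOn ℝ Set.univ φ)
    (hc : Continuous φ) (hI : Integrable (fun x => Real.exp (-φ x))) :
    Integrable (fun x => Real.exp (-φ x / 2)) := by
  have h1 : Integrable (fun x => Real.exp (φ 0 / 2) * Real.exp (-φ ((1 / 2 : ℝ) • x))) :=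
    (hI.comp_smul (R := (1 / 2 : ℝ)) (by norm_num)).const_mul _
  refine h1.mono' (by fun_prop) (ae_of_all _ fun x => ?_)
  rw [Real.norm_eq_abs, abs_of_pos (Real.exp_pos _), ← Real.exp_add]
  apply Real.exp_le_exp.2
  have := aux_mid hφ 0 x
  rw [add_zero] at this
  linarith

lemma aux_bdd {φ : EuclideanSpace ℝ (Fin n) → ℝ} (hφ : ConvexOn ℝ Set.univ φ)
    (hc : Continuous φ) (hI : Integrable (fun x => Real.exp (-φ x))) :
    ∃ B : ℝ, 0 ≤ B ∧ ∀ x, -B ≤ φ x := by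
  have hh := aux_half hφ hc hI
  have hpos : 0 < ∫ x, Real.exp (-φ x / 2) := integral_exp_pos hh
  have h1 : Integrable (fun x => Real.exp (-φ ((1 / 2 : ℝ) • x))) :=
    (hI.comp_smul (R := (1 / 2 : ℝ)) (by norm_num))
  set A := ∫ x, Real.exp (-φ ((1 / 2 : ℝ) • x)) with hA
  set c := ∫ x, Real.exp (-φ x / 2) with hcdef
  have hA0 : 0 ≤ A := integral_nonneg fun x => (Real.exp_pos _).le
  refine ⟨2 * (A / c), by positivity, fun x => ?_⟩
  have key : Real.exp (-φ x / 2) * c ≤ A := by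
    rw [hA, ← integral_add_right_eq_self (fun z => Real.exp (-φ ((1 / 2 : ℝ) • z))) x, hcdef,
      ← integral_const_mul]
    refine integral_mono (hh.const_mul _) (h1.comp_add_right x) fun y => ?_
    simp only
    rw [← Real.exp_add]
    apply Real.exp_le_exp.2
    have := aux_mid hφ x y
    linarith
  have h2 : Real.exp (-φ x / 2) ≤ A / c := (le_div_iff₀ hpos).2 key
  have h3 := Real.add_one_le_exp (-φ x / 2)
  linarith

lemma aux_int {φ : EuclideanSpace ℝ (Fin n) → ℝ} (hφ : ConvexOn ℝ Set.univ φ)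
    (hc : Continuous φ) (hI : Integrable (fun x => Real.exp (-φ x))) :
    Integrable (fun x => Real.exp (-φ x) * φ x) := by
  obtain ⟨B, hB0, hB⟩ := aux_bdd hφ hc hI
  have h1 := (hI.const_mul B).add ((aux_half hφ hc hI).const_mul 2)
  refine h1.mono' (by fun_prop) (ae_of_all _ fun x => ?_)
  simp only [Pi.add_apply]
  rw [norm_mul, Real.norm_eq_abs, abs_of_pos (Real.exp_pos _), Real.norm_eq_abs]
  have e1 := Real.exp_pos (-φ x)
  have e2 := Real.exp_pos (-φ x / 2)
  rcases le_total 0 (φ x) with h | h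
  · rw [abs_of_nonneg h]
    have h3 := Real.add_one_le_exp (φ x / 2)
    have h4 : Real.exp (-φ x / 2) = Real.exp (-φ x) * Real.exp (φ x / 2) := by
      rw [← Real.exp_add]; ring_nf
    rw [h4]
    nlinarith
  · rw [abs_of_nonpos h]
    nlinarith [hB x]

lemma aux_cutoff (i : Fin n) : ∃ h : EuclideanSpace ℝ (Fin n) → ℝ,
    ContDiff ℝ (⊤ : ℕ∞) h ∧ HasCompactSupport h ∧ (∀ᶠ x in 𝓝 0, h x = x i) ∧
    ‖fderiv ℝ h 0‖ ≤ 1 := by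
  let χ : ContDiffBump (0 : EuclideanSpace ℝ (Fin n)) := ⟨1, 2, by norm_num, by norm_num⟩
  have hev : ∀ᶠ x in 𝓝 0, x i * χ x = x i := by
    filter_upwards [χ.eventuallyEq_one] with x hx
    rw [hx]; simp
  refine ⟨fun x => x i * χ x, ?_, ?_, hev, ?_⟩
  · exact ContDiff.mul (by fun_prop) χ.contDiff
  · exact χ.hasCompactSupport.mul_left
  · have : (fun x => x i * χ x) =ᶠ[𝓝 0] (EuclideanSpace.proj i : EuclideanSpace ℝ (Fin n) →L[ℝ] ℝ) := hev
    rw [this.fderiv_eq, ContinuousLinearMap.fderiv]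
    refine ContinuousLinearMap.opNorm_le_bound _ zero_le_one fun x => ?_
    rw [one_mul]
    exact PiLp.norm_apply_le x i

lemma aux_coord (μ : Measure (EuclideanSpace ℝ (Fin n))) [IsProbabilityMeasure μ]
    {C : ℝ} (hC : 0 < C) (hP : SatisfiesPoincare μ C) (i : Fin n) :
    ∃ m : ℝ, ∫⁻ x, ENNReal.ofReal ((x i - m) ^ 2) ∂μ ≤ ENNReal.ofReal C := by
  obtain ⟨h, hsm, hcs, hev, hnorm⟩ := aux_cutoff i
  let r : ℕ → ℝ := fun k => 1 / ((k : ℝ) + 1)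
  have hr : ∀ k, 0 < r k := fun k => by positivity
  have hrt : Tendsto r atTop (𝓝 0) := tendsto_one_div_add_atTop_nhds_zero_nat
  let f : ℕ → EuclideanSpace ℝ (Fin n) → ℝ := fun k x => (r k)⁻¹ * h (r k • x)
  have hfs : ∀ k, ContDiff ℝ (⊤ : ℕ∞) (f k) := fun k => by
    have : ContDiff ℝ (⊤ : ℕ∞) (fun x : EuclideanSpace ℝ (Fin n) => r k • x) := by fun_prop
    exact contDiff_const.mul (hsm.comp this)
  have hfc : ∀ k, HasCompactSupport (f k) := fun k =>
    (hcs.comp_smul (hr k).ne').mul_left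
  have hgrad : ∀ k x, ‖gradient (f k) x‖ = ‖fderiv ℝ h (r k • x)‖ := fun k x => by
    have e1 : ‖gradient (f k) x‖ = ‖fderiv ℝ (f k) x‖ := by
      rw [← toDual_gradient, LinearIsometryEquiv.norm_map]
    have hd : DifferentiableAt ℝ (fun x => h (r k • x)) x := by
      have := (hsm.differentiable (by simp)) (r k • x)
      exact this.comp x (by fun_prop)
    rw [e1, fderiv_const_mul hd, fderiv_comp_smul, smul_smul, inv_mul_cancel₀ (hr k).ne', one_smul]
  have hdc : Continuous (fderiv ℝ h) := hsm.continuous_fderiv (by simp)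
  obtain ⟨K, hK⟩ := hdc.bounded_above_of_compact_support (hcs.fderiv (𝕜 := ℝ))
  have hsmul : ∀ x : EuclideanSpace ℝ (Fin n), Tendsto (fun k => r k • x) atTop (𝓝 0) := fun x => by
    simpa using hrt.smul_const x
  -- convergence of the Dirichlet energies
  have hE : Tendsto (fun k => ∫ x, ‖gradient (f k) x‖ ^ 2 ∂μ) atTop
      (𝓝 (‖fderiv ℝ h 0‖ ^ 2)) := by
    have : (‖fderiv ℝ h 0‖ ^ 2) = ∫ _x, ‖fderiv ℝ h 0‖ ^ 2 ∂μ := by simp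
    rw [this]
    simp only [hgrad]
    refine tendsto_integral_of_dominated_convergence (fun _ => K ^ 2) ?_ (by fun_prop) ?_ ?_
    · intro k
      have : Continuous fun x : EuclideanSpace ℝ (Fin n) => ‖fderiv ℝ h (r k • x)‖ ^ 2 := by
        exact ((hdc.comp (by fun_prop)).norm.pow 2)
      exact this.aestronglyMeasurable
    · intro k
      refine ae_of_all _ fun x => ?_
      rw [norm_pow, norm_norm]
      exact pow_le_pow_left₀ (norm_nonneg _) (hK _) 2
    · refine ae_of_all _ fun x => ?_
      exact (((hdc.tendsto 0).comp (hsmul x)).norm.pow 2)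
  have hft : ∀ x : EuclideanSpace ℝ (Fin n), Tendsto (fun k => f k x) atTop (𝓝 (x i)) := fun x => by
    refine tendsto_const_nhds.congr' ?_
    filter_upwards [(hsmul x).eventually hev] with k hk
    simp only [f, hk, PiLp.smul_apply, smul_eq_mul]
    rw [← mul_assoc, inv_mul_cancel₀ (hr k).ne', one_mul]
  let m : ℕ → ℝ := fun k => ∫ y, f k y ∂μ
  have hfcont : ∀ k, Continuous (f k) := fun k => (hfs k).continuous
  have hvar : ∀ k, ∫⁻ x, ENNReal.ofReal ((f k x - m k) ^ 2) ∂μ ≤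
      ENNReal.ofReal (C * ∫ x, ‖gradient (f k) x‖ ^ 2 ∂μ) := fun k => by
    have hint : Integrable (fun x => (f k x - m k) ^ 2) μ := by
      obtain ⟨M, hM⟩ := (hfcont k).bounded_above_of_compact_support (hfc k)
      refine Integrable.of_bound (C := (M + ‖m k‖) ^ 2) ?_ (ae_of_all _ fun x => ?_)
      · have := hfcont k
        exact Continuous.aestronglyMeasurable (by fun_prop)
      · rw [norm_pow]
        exact pow_le_pow_left₀ (norm_nonneg _) ((norm_sub_le _ _).trans (by gcongr; exact hM x)) 2
    rw [← ofReal_integral_eq_lintegral_ofReal hint (ae_of_all _ fun x => sq_nonneg _)]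
    exact ENNReal.ofReal_le_ofReal (hP (f k) (hfs k) (hfc k))
  have hub : Tendsto (fun k => ENNReal.ofReal (C * ∫ x, ‖gradient (f k) x‖ ^ 2 ∂μ)) atTop
      (𝓝 (ENNReal.ofReal (C * ‖fderiv ℝ h 0‖ ^ 2))) :=
    ENNReal.tendsto_ofReal (hE.const_mul C)
  have hmeas : ∀ k, Measurable fun x => ENNReal.ofReal ((f k x - m k) ^ 2) := fun k => by
    have := (hfcont k).measurable
    fun_prop
  have hliminf : ∀ s : ℕ → ℕ, Tendsto s atTop atTop →
      ∫⁻ x, liminf (fun k => ENNReal.ofReal ((f (s k) x - m (s k)) ^ 2)) atTop ∂μ ≤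
        ENNReal.ofReal (C * ‖fderiv ℝ h 0‖ ^ 2) := fun s hs => by
    refine (lintegral_liminf_le fun k => hmeas (s k)).trans ?_
    rw [← (hub.comp hs).liminf_eq]
    exact liminf_le_liminf (Eventually.of_forall fun k => hvar (s k))
  have hlast : ENNReal.ofReal (C * ‖fderiv ℝ h 0‖ ^ 2) ≤ ENNReal.ofReal C := by
    apply ENNReal.ofReal_le_ofReal
    have : ‖fderiv ℝ h 0‖ ^ 2 ≤ 1 := pow_le_one₀ (norm_nonneg _) hnorm
    nlinarith
  -- a bounded subsequence of the means
  have hfin := hliminf id tendsto_id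
  have hae := ae_lt_top (μ := μ) (Measurable.liminf fun k => hmeas k)
    (ne_top_of_le_ne_top ENNReal.ofReal_ne_top hfin)
  obtain ⟨x0, hx0⟩ := hae.exists
  obtain ⟨b, hb1, hb2⟩ := exists_between hx0
  have hfreq := frequently_lt_of_liminf_lt (by isBoundedDefault) hb1
  have hev1 : ∀ᶠ k in atTop, |f k x0 - x0 i| < 1 := by
    have := (Metric.tendsto_nhds.1 (hft x0)) 1 one_pos
    simpa [Real.dist_eq] using this
  have hfb : ∃ᶠ k in atTop, m k ∈ Metric.closedBall (x0 i) (b.toReal + 2) := by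
    refine (hfreq.and_eventually hev1).mono fun k ⟨h1, h2⟩ => ?_
    have h3 : (f k x0 - m k) ^ 2 < b.toReal := (ENNReal.ofReal_lt_iff_lt_toReal (sq_nonneg _) hb2.ne).1 h1
    rw [Metric.mem_closedBall, Real.dist_eq]
    rw [abs_lt] at h2
    rw [abs_le]
    constructor <;> nlinarith [sq_nonneg (f k x0 - m k - 1), sq_nonneg (f k x0 - m k + 1)]
  obtain ⟨a, -, s, hs, hsa⟩ := tendsto_subseq_of_frequently_bounded Metric.isBounded_closedBall hfb
  refine ⟨a, ?_⟩
  have hfinal := hliminf s hs.tendsto_atTop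
  refine le_trans (le_of_eq ?_) (hfinal.trans hlast)
  refine lintegral_congr fun x => ?_
  symm
  apply Tendsto.liminf_eq
  exact ENNReal.tendsto_ofReal ((((hft x).comp hs.tendsto_atTop).sub hsa).pow 2)

lemma aux_moment (μ : Measure (EuclideanSpace ℝ (Fin n))) [IsProbabilityMeasure μ]
    {C : ℝ} (hC : 0 < C) (hP : SatisfiesPoincare μ C) :
    ∃ m : EuclideanSpace ℝ (Fin n), Integrable (fun x => ‖x - m‖ ^ 2) μ ∧
      ∫ x, ‖x - m‖ ^ 2 ∂μ ≤ n * C := by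
  choose m hm using aux_coord μ hC hP
  have hi : ∀ i, Integrable (fun x : EuclideanSpace ℝ (Fin n) => (x i - m i) ^ 2) μ := fun i => by
    refine ⟨Continuous.aestronglyMeasurable (by fun_prop), ?_⟩
    rw [hasFiniteIntegral_iff_ofReal (ae_of_all _ fun x => sq_nonneg _)]
    exact (hm i).trans_lt ENNReal.ofReal_lt_top
  have hb : ∀ i, ∫ x : EuclideanSpace ℝ (Fin n), (x i - m i) ^ 2 ∂μ ≤ C := fun i => by
    have := hm i
    rw [← ofReal_integral_eq_lintegral_ofReal (hi i) (ae_of_all _ fun x => sq_nonneg _)] at this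
    exact (ENNReal.ofReal_le_ofReal_iff hC.le).1 this
  have he : (fun x : EuclideanSpace ℝ (Fin n) => ‖x - WithLp.toLp 2 m‖ ^ 2) = fun x => ∑ i, (x i - m i) ^ 2 := by
    funext x
    simp [EuclideanSpace.norm_sq_eq]
  refine ⟨WithLp.toLp 2 m, ?_, ?_⟩
  · rw [he]
    exact integrable_finsetSum _ fun i _ => hi i
  · rw [he, integral_finsetSum _ fun i _ => hi i]
    refine (Finset.sum_le_sum fun i _ => hb i).trans ?_
    simp

end Helpers

/-- **Entropy bound under Poincaré.**
If `μ = e^{-φ} dx` is a log-concave probability measure on `ℝⁿ` (`φ` convex) satisfying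
the Poincaré inequality with constant `C_P`, then
`inf φ ≤ ∫ φ dμ ≤ (n/2) log(2πe C_P)`. -/
theorem inf_potential_le_entropy_le
    (n : ℕ) (hn : 1 ≤ n)
    (φ : EuclideanSpace ℝ (Fin n) → ℝ) (hφconv : ConvexOn ℝ Set.univ φ)
    (μ : Measure (EuclideanSpace ℝ (Fin n)))
    (hμ : μ = volume.withDensity fun x => ENNReal.ofReal (Real.exp (-φ x)))
    (hμprob : IsProbabilityMeasure μ)
    (CP : ℝ) (hCP : 0 < CP) (hPoin : SatisfiesPoincare μ CP) :
    sInf (Set.range φ) ≤ ∫ x, φ x ∂μ ∧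
      ∫ x, φ x ∂μ ≤ (n / 2 : ℝ) * Real.log (2 * Real.pi * Real.exp 1 * CP) := by
  have hc : Continuous φ := by
    rw [← continuousOn_univ]; exact hφconv.continuousOn isOpen_univ
  have hdm : Measurable fun x => ENNReal.ofReal (Real.exp (-φ x)) := by
    have := hc.measurable
    fun_prop
  have hI : Integrable (fun x => Real.exp (-φ x)) := by
    refine ⟨by fun_prop, ?_⟩
    rw [hasFiniteIntegral_iff_ofReal (ae_of_all _ fun x => (Real.exp_pos _).le)]
    have := hμprob.measure_univ
    rw [hμ, withDensity_apply _ MeasurableSet.univ, Measure.restrict_univ] at this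
    rw [this]; exact ENNReal.one_lt_top
  have hItop : ∀ g : EuclideanSpace ℝ (Fin n) → ℝ,
      (Integrable g μ ↔ Integrable (fun x => Real.exp (-φ x) * g x)) := fun g => by
    rw [hμ, integrable_withDensity_iff_integrable_smul' hdm (ae_of_all _ fun x => by simp)]
    simp [ENNReal.toReal_ofReal (Real.exp_pos _).le]
  have hint : ∀ g : EuclideanSpace ℝ (Fin n) → ℝ,
      ∫ x, g x ∂μ = ∫ x, Real.exp (-φ x) * g x := fun g => by
    rw [hμ, integral_withDensity_eq_integral_toReal_smul hdm (ae_of_all _ fun x => by simp)]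
    simp [ENNReal.toReal_ofReal (Real.exp_pos _).le]
  have hφI : Integrable φ μ := (hItop φ).2 (aux_int hφconv hc hI)
  have hone : ∫ x, Real.exp (-φ x) = 1 := by
    have := hint (fun _ => 1)
    simpa using this.symm
  constructor
  · obtain ⟨B, -, hB⟩ := aux_bdd hφconv hc hI
    have hbd : BddBelow (Set.range φ) := ⟨-B, by rintro _ ⟨x, rfl⟩; exact hB x⟩
    have : ∫ _x, sInf (Set.range φ) ∂μ ≤ ∫ x, φ x ∂μ :=
      integral_mono (integrable_const _) hφI fun x => csInf_le hbd ⟨x, rfl⟩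
    simpa using this
  · obtain ⟨m, hm1, hm2⟩ := aux_moment μ hCP hPoin
    set L : ℝ := (n / 2 : ℝ) * Real.log (2 * Real.pi * CP) with hL
    have hgI : Integrable (fun x => L + ‖x - m‖ ^ 2 / (2 * CP)) μ :=
      (integrable_const _).add (hm1.div_const _)
    have hbpos : 0 < 1 / (2 * CP) := by positivity
    have hG : ∫ x, Real.exp (-(L + ‖x - m‖ ^ 2 / (2 * CP))) = 1 := by
      have h1 := GaussianFourier.integral_rexp_neg_mul_sq_norm
        (V := EuclideanSpace ℝ (Fin n)) hbpos
      rw [← integral_sub_right_eq_self _ m] at h1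
      have h2 : ∀ x : EuclideanSpace ℝ (Fin n), Real.exp (-(L + ‖x - m‖ ^ 2 / (2 * CP))) =
          Real.exp (-L) * Real.exp (-(1 / (2 * CP)) * ‖x - m‖ ^ 2) := fun x => by
        rw [← Real.exp_add]; congr 1; ring
      simp only [h2]
      rw [integral_const_mul, h1, finrank_euclideanSpace_fin,
        Real.rpow_def_of_pos (by positivity), ← Real.exp_add, Real.exp_eq_one_iff, hL]
      have : Real.pi / (1 / (2 * CP)) = 2 * Real.pi * CP := by field_simp
      rw [this]; ring
    have hGI : Integrable (fun x => Real.exp (-(L + ‖x - m‖ ^ 2 / (2 * CP)))) :=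
      integrable_of_integral_eq_one hG
    have hle : ∫ x, (φ x - (L + ‖x - m‖ ^ 2 / (2 * CP))) ∂μ ≤ 0 := by
      rw [hint]
      have h1 := (hItop _).1 (hφI.sub hgI)
      have h2 : ∫ x, (Real.exp (-(L + ‖x - m‖ ^ 2 / (2 * CP))) - Real.exp (-φ x)) = 0 := by
        rw [integral_sub hGI hI, hG, hone, sub_self]
      rw [← h2]
      refine integral_mono h1 (hGI.sub hI) fun x => ?_
      simp only [Pi.sub_apply]
      set g := L + ‖x - m‖ ^ 2 / (2 * CP)
      have h3 := Real.add_one_le_exp (φ x - g)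
      have h4 : Real.exp (-g) = Real.exp (-φ x) * Real.exp (φ x - g) := by
        rw [← Real.exp_add]; ring_nf
      rw [h4]
      nlinarith [Real.exp_pos (-φ x)]
    rw [integral_sub hφI hgI, integral_add (integrable_const _) (hm1.div_const _),
      integral_div] at hle
    simp only [integral_const, probReal_univ, one_smul] at hle
    have h5 : (∫ x, ‖x - m‖ ^ 2 ∂μ) / (2 * CP) ≤ n / 2 := by
      rw [div_le_iff₀ (by positivity)]
      linarith
    have h6 : Real.log (2 * Real.pi * Real.exp 1 * CP) = Real.log (2 * Real.pi * CP) + 1 := by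
      have : 2 * Real.pi * Real.exp 1 * CP = (2 * Real.pi * CP) * Real.exp 1 := by ring
      rw [this, Real.log_mul (by positivity) (Real.exp_pos 1).ne', Real.log_exp]
    rw [h6]
    linarith
end
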